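/- Let Y be a finite group and N ⊴ Y a normal subgroup with Y/N abelian, and suppose that every irreducible complex character θ of N extends to its inertia group Y_θ. Then for every subgroup X with N ≤ X ≤ Y, every irreducible complex character χ of X extends to its inertia group Y_χ = {y ∈ Y : χ(yxy⁻¹) = χ(x) for all x ∈ X}. (Abstract form of Theorem 3.6, second assertion.) -/

import Mathlib

open CategoryTheory

/-- The inertia subgroup `Y_f` of a function `f` on a normal subgroup `N ⊴ Y`:
elements `y ∈ Y` such that `f(y n y⁻¹) = f(n)` for all `n ∈ N`. -/
def inertia {Y : Type*} [Group Y] (N : Subgroup Y) (hN : N.Normal) (f : ↥N → ℂ) :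
    Subgroup Y where
  carrier := {y : Y | ∀ (x : Y) (hx : x ∈ N) (hx' : y * x * y⁻¹ ∈ N),
      f ⟨y * x * y⁻¹, hx'⟩ = f ⟨x, hx⟩}
  one_mem' := by
    intro x hx hx'
    have h : (⟨1 * x * 1⁻¹, hx'⟩ : ↥N) = ⟨x, hx⟩ := Subtype.ext (by group)
    rw [h]
  mul_mem' := by
    intro a b ha hb x hx hx'
    have h1 : b * x * b⁻¹ ∈ N := hN.conj_mem x hx b
    have h2 : a * (b * x * b⁻¹) * a⁻¹ ∈ N := hN.conj_mem _ h1 a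
    have h : (⟨a * b * x * (a * b)⁻¹, hx'⟩ : ↥N) = ⟨a * (b * x * b⁻¹) * a⁻¹, h2⟩ :=
      Subtype.ext (by group)
    rw [h, ha _ h1 h2, hb x hx h1]
  inv_mem' := by
    intro a ha x hx hx'
    have h1 : a * (a⁻¹ * x * a⁻¹⁻¹) * a⁻¹ ∈ N := hN.conj_mem _ hx' a
    have key := ha _ hx' h1
    have h : (⟨a * (a⁻¹ * x * a⁻¹⁻¹) * a⁻¹, h1⟩ : ↥N) = ⟨x, hx⟩ := Subtype.ext (by group)
    rw [h] at key
    exact key.symm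

universe u v

theorem exists_common_eigenvector {ι M : Type*} [AddCommGroup M] [Module ℂ M]
    [FiniteDimensional ℂ M] [Nontrivial M] (A : ι → Module.End ℂ M)
    (hA : ∀ i j, Commute (A i) (A j)) :
    ∃ v : M, v ≠ 0 ∧ ∀ i, ∃ c : ℂ, A i v = c • v := by
  induction hn : Module.finrank ℂ M using Nat.strong_induction_on generalizing M with
  | _ n ih =>
    by_cases hscal : ∀ i, ∃ c : ℂ, ∀ v, A i v = c • v
    · obtain ⟨v, hv⟩ := exists_ne (0 : M)
      exact ⟨v, hv, fun i ↦ (hscal i).imp fun c hc ↦ hc v⟩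
    · push Not at hscal
      obtain ⟨i, hi⟩ := hscal
      obtain ⟨μ, hμ⟩ := Module.End.exists_eigenvalue (A i)
      set p := (A i).eigenspace μ
      have hp : ∀ j, ∀ v ∈ p, A j v ∈ p := fun j v hv ↦ by
        rw [Module.End.mem_eigenspace_iff] at hv ⊢
        rw [← Module.End.mul_apply, (hA i j).eq, Module.End.mul_apply, hv, map_smul]
      have hlt : Module.finrank ℂ p < n := by
        rw [← hn]
        refine Submodule.finrank_lt fun htop ↦ ?_
        obtain ⟨v, hv⟩ := hi μ
        exact hv (Module.End.mem_eigenspace_iff.mp (htop ▸ Submodule.mem_top : v ∈ p))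
      have : Nontrivial p := Submodule.nontrivial_iff_ne_bot.mpr hμ
      obtain ⟨v, hv, h⟩ := ih _ hlt (fun j ↦ (A j).restrict (hp j))
        (fun j k ↦ by
          ext v
          exact LinearMap.congr_fun (hA j k).eq (v : M)) rfl
      exact ⟨v, by simpa using hv, fun j ↦ (h j).imp fun c hc ↦ congrArg Subtype.val hc⟩

namespace Representation

variable {G V W : Type*} [Group G] [AddCommGroup V] [Module ℂ V] [AddCommGroup W] [Module ℂ W]

theorem isIrreducible_of_forall [Nontrivial V] {ρ : Representation ℂ G V}
    (h : ∀ p : Subrepresentation ρ, p = ⊥ ∨ p = ⊤) : ρ.IsIrreducible where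
  exists_pair_ne := ⟨⊥, ⊤, fun heq ↦ bot_ne_top (congrArg Subrepresentation.toSubmodule heq)⟩
  eq_bot_or_eq_top := h

theorem exists_irreducible_subrepresentation [FiniteDimensional ℂ V] [Nontrivial V]
    (ρ : Representation ℂ G V) :
    ∃ p : Subrepresentation ρ, p.toRepresentation.IsIrreducible := by
  obtain ⟨p, hp, hmin⟩ := WellFounded.has_min
    (InvImage.wf (fun p : Subrepresentation ρ ↦ Module.finrank ℂ p.toSubmodule) wellFounded_lt)
    {p | p ≠ ⊥} ⟨⊤, fun heq ↦ top_ne_bot (congrArg Subrepresentation.toSubmodule heq)⟩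
  have hp' : p.toSubmodule ≠ ⊥ := fun h ↦ hp (Subrepresentation.toSubmodule_injective h)
  have : Nontrivial p.toSubmodule := Submodule.nontrivial_iff_ne_bot.mpr hp'
  refine ⟨p, isIrreducible_of_forall fun q ↦ ?_⟩
  let r : Subrepresentation ρ :=
    ⟨q.toSubmodule.map p.toSubmodule.subtype, by
      rintro g _ ⟨v, hv, rfl⟩
      exact ⟨_, q.apply_mem_toSubmodule g hv, rfl⟩⟩
  by_cases hr : r = ⊥
  · left
    apply Subrepresentation.toSubmodule_injective
    exact Submodule.map_injective_of_injective p.toSubmodule.injective_subtype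
      ((congrArg Subrepresentation.toSubmodule hr).trans (Submodule.map_bot _).symm)
  · right
    apply Subrepresentation.toSubmodule_injective
    have h := not_lt.mp (hmin r hr)
    apply Submodule.eq_top_of_finrank_eq
    apply le_antisymm (Submodule.finrank_le _)
    exact h.trans (Submodule.finrank_map_subtype_eq _ _).le

variable [FiniteDimensional ℂ V] [FiniteDimensional ℂ W] [Finite G]

theorem finrank_intertwiningMap_comm (ρ : Representation ℂ G V) (σ : Representation ℂ G W) :
    Module.finrank ℂ (IntertwiningMap ρ σ) = Module.finrank ℂ (IntertwiningMap σ ρ) := by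
  have := Fintype.ofFinite G
  have : Invertible (Nat.card G : ℂ) := invertibleOfNonzero (by simp)
  rw [← Nat.cast_inj (R := ℂ), ← card_inv_mul_sum_char_mul_char_eq_finrank,
    ← card_inv_mul_sum_char_mul_char_eq_finrank]
  congr 1
  exact Fintype.sum_equiv (Equiv.inv G) _ _ fun g ↦ by simp [mul_comm]

theorem exists_intertwiningMap_ne_zero_symm {ρ : Representation ℂ G V} {σ : Representation ℂ G W}
    {f : IntertwiningMap ρ σ} (hf : f ≠ 0) : ∃ g : IntertwiningMap σ ρ, g ≠ 0 := by
  have h : 0 < Module.finrank ℂ (IntertwiningMap ρ σ) :=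
    Module.finrank_pos_iff_exists_ne_zero.mpr ⟨f, hf⟩
  rw [finrank_intertwiningMap_comm] at h
  exact Module.finrank_pos_iff_exists_ne_zero.mp h

theorem nonempty_equiv_of_character_eq (ρ : Representation ℂ G V) (σ : Representation ℂ G W)
    [IsIrreducible ρ] (h : ρ.character = σ.character) : Nonempty (Equiv ρ σ) := by
  have := Fintype.ofFinite G
  have : Invertible (Nat.card G : ℂ) := invertibleOfNonzero (by simp)
  have h1 : Module.finrank ℂ (IntertwiningMap ρ σ) = 1 := by
    rw [← IsIrreducible.finrank_intertwiningMap_self ρ, ← Nat.cast_inj (R := ℂ),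
      ← card_inv_mul_sum_char_mul_char_eq_finrank, ← card_inv_mul_sum_char_mul_char_eq_finrank, h]
  obtain ⟨f, hf⟩ := Module.finrank_pos_iff_exists_ne_zero.mp (h1 ▸ one_pos :
    0 < Module.finrank ℂ (IntertwiningMap ρ σ))
  have hinj := (IsIrreducible.injective_or_eq_zero f).resolve_right hf
  have hdim : Module.finrank ℂ V = Module.finrank ℂ W := by
    have := congrFun h 1
    rw [char_one, char_one] at this
    exact_mod_cast this
  exact ⟨f.ofBijective ⟨hinj,
    (LinearMap.injective_iff_surjective_of_finrank_eq_finrank hdim (f := f.toLinearMap)).mp hinj⟩⟩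


section Multiplicity

variable {A E H : Type*} [Group A] [Group H] [AddCommGroup E] [Module ℂ E]
  [FiniteDimensional ℂ E]

/-- If `H` is commutative modulo `ι A` and `θ` extends to `T`, some nonzero intertwining map is
`T`-equivariant up to scalars. -/
theorem exists_semiinvariant_intertwiningMap (ι : A →* H) (σ : Representation ℂ H W)
    (θ : Representation ℂ A E) (T : Subgroup H) (hιT : ∀ a, ι a ∈ T) (θ' : Representation ℂ T E)
    (hθ' : ∀ a, θ' ⟨ι a, hιT a⟩ = θ a) (hnorm : ∀ h a, ∃ b, ι b = h * ι a * h⁻¹)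
    (hcomm : ∀ s t : H, ∃ a, s * t = ι a * (t * s))
    [Nontrivial (IntertwiningMap θ (MonoidHom.comp σ ι))] :
    ∃ i : IntertwiningMap θ (MonoidHom.comp σ ι), i ≠ 0 ∧
      ∀ t : T, ∃ c : ℂ, ∀ e, σ t (i e) = c • i (θ' t e) := by
  have hi (f : IntertwiningMap θ (MonoidHom.comp σ ι)) (a : A) (e : E) :
      f (θ a e) = σ (ι a) (f e) := f.isIntertwining _ _ a e
  let act (t : T) : Module.End ℂ (IntertwiningMap θ (MonoidHom.comp σ ι)) :=
    { toFun := fun f ↦ LinearMap.intertwiningMap_of_isIntertwiningMap _ _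
        (σ t ∘ₗ f.toLinearMap ∘ₗ θ' t⁻¹) (by
          intro a e
          obtain ⟨b, hb⟩ := hnorm (t : H)⁻¹ a
          rw [inv_inv] at hb
          have h1 : t⁻¹ * ⟨ι a, hιT a⟩ = ⟨ι b, hιT b⟩ * t⁻¹ := Subtype.ext (by simp [hb])
          have h2 : (t : H) * ι b = ι a * t := by simp [hb, mul_assoc]
          have h3 : θ' t⁻¹ (θ a e) = θ b (θ' t⁻¹ e) := by
            rw [← hθ', ← hθ', ← Module.End.mul_apply, ← map_mul, h1, map_mul, Module.End.mul_apply]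
          simp only [LinearMap.comp_apply, IntertwiningMap.toLinearMap_apply, MonoidHom.comp_apply]
          rw [h3, hi, ← Module.End.mul_apply, ← map_mul, h2, map_mul, Module.End.mul_apply])
      map_add' := fun f g ↦ by
        ext e
        exact map_add (σ t) _ _
      map_smul' := fun c f ↦ by
        ext e
        exact map_smul (σ t) _ _ }
  have hact (t : T) (f : IntertwiningMap θ (MonoidHom.comp σ ι)) (e : E) :
      act t f e = σ t (f (θ' t⁻¹ e)) := rfl
  have hmul (s t : T) : act (s * t) = act s * act t := by
    ext f e
    change act (s * t) f e = act s (act t f) e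
    simp [hact]
  have hone (a : A) : act ⟨ι a, hιT a⟩ = 1 := by
    ext f e
    change act _ f e = f e
    rw [hact]
    change σ (ι a) (f _) = _
    rw [← hi, ← hθ', ← Module.End.mul_apply, ← map_mul, mul_inv_cancel, map_one,
      Module.End.one_apply]
  obtain ⟨i, hi0, h⟩ := exists_common_eigenvector act fun s t ↦ by
    obtain ⟨a, ha⟩ := hcomm s t
    have : s * t = ⟨ι a, hιT a⟩ * (t * s) := Subtype.ext ha
    rw [Commute, SemiconjBy, ← hmul, this, hmul, hone, one_mul, hmul]
  refine ⟨i, hi0, fun t ↦ (h t).imp fun c hc e ↦ ?_⟩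
  have := congrArg (fun f ↦ f (θ' t e)) hc
  simpa [hact] using this

/-- Multiplicity one for an irreducible `σ` restricted along `ι`, when `H` is commutative modulo
`ι A` and `θ` extends to a subgroup `T` containing its stabilizer. -/
theorem intertwiningMap_eq_smul_of_ne_zero (ι : A →* H) (σ : Representation ℂ H W)
    [Finite A] [IsIrreducible σ]
    (θ : Representation ℂ A E) [IsIrreducible θ]
    (T : Subgroup H) (hιT : ∀ a, ι a ∈ T) (θ' : Representation ℂ T E)
    (hθ' : ∀ a, θ' ⟨ι a, hιT a⟩ = θ a) (hnorm : ∀ h a, ∃ b, ι b = h * ι a * h⁻¹)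
    (hcomm : ∀ s t : H, ∃ a, s * t = ι a * (t * s))
    (hT : ∀ h ∉ T, ∀ B : E →ₗ[ℂ] E,
      (∀ a b, ι b = h * ι a * h⁻¹ → B ∘ₗ θ a = θ b ∘ₗ B) → B = 0)
    (g₁ g₂ : IntertwiningMap (MonoidHom.comp σ ι) θ) (hg₁ : g₁ ≠ 0) :
    ∃ c : ℂ, g₂ = c • g₁ := by
  obtain ⟨f₀, hf₀⟩ := exists_intertwiningMap_ne_zero_symm hg₁
  have : Nontrivial (IntertwiningMap θ (MonoidHom.comp σ ι)) := ⟨f₀, 0, hf₀⟩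
  obtain ⟨i, hi0, hi⟩ := exists_semiinvariant_intertwiningMap ι σ θ T hιT θ' hθ' hnorm hcomm
  have hg (g : IntertwiningMap (MonoidHom.comp σ ι) θ) (a : A) (w : W) :
      g (σ (ι a) w) = θ a (g w) := g.isIntertwining _ _ a w
  have hinj (g : IntertwiningMap (MonoidHom.comp σ ι) θ) (h0 : g.comp i = 0) : g = 0 := by
    have h0' (e : E) : g (i e) = 0 := congrArg (fun f ↦ f e) h0
    have hz (h : H) (e : E) : g (σ h (i e)) = 0 := by
      by_cases hh : h ∈ T
      · obtain ⟨c, hc⟩ := hi ⟨h, hh⟩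
        have := hc e
        simp only at this
        rw [this, map_smul, h0', smul_zero]
      · refine LinearMap.congr_fun (hT h hh (g.toLinearMap ∘ₗ σ h ∘ₗ i.toLinearMap) ?_) e
        intro a b hab
        ext e
        have h1 : i (θ a e) = σ (ι a) (i e) := i.isIntertwining _ _ a e
        have h2 : h * ι a = ι b * h := by simp [hab]
        simp only [LinearMap.comp_apply, IntertwiningMap.toLinearMap_apply]
        rw [h1, ← Module.End.mul_apply, ← map_mul, h2, map_mul, Module.End.mul_apply, hg]
    let p : Subrepresentation σ :=
      ⟨⨅ h : H, LinearMap.ker (g.toLinearMap ∘ₗ σ h), fun h w hw ↦ by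
        simp only [Submodule.mem_iInf, LinearMap.mem_ker, LinearMap.comp_apply] at hw ⊢
        intro k
        have := hw (k * h)
        rwa [map_mul, Module.End.mul_apply] at this⟩
    have hmem (w : W) : w ∈ p ↔ ∀ h, g (σ h w) = 0 := by
      change w ∈ (⨅ h : H, LinearMap.ker (g.toLinearMap ∘ₗ σ h)) ↔ _
      simp
    rcases eq_bot_or_eq_top p with hp | hp
    · refine absurd ?_ hi0
      ext e
      have : i e ∈ p := (hmem _).mpr fun h ↦ hz h e
      rw [hp] at this
      exact this
    · ext w
      have : w ∈ p := hp ▸ Submodule.mem_top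
      simpa using (hmem w).mp this 1
  have hbij := IsIrreducible.algebraMap_intertwiningMap_bijective_of_isAlgClosed (k := ℂ) (ρ := θ)
  obtain ⟨c₁, hc₁⟩ := hbij.2 (g₁.comp i)
  obtain ⟨c₂, hc₂⟩ := hbij.2 (g₂.comp i)
  have hc₁0 : c₁ ≠ 0 := by
    rintro rfl
    exact hg₁ (hinj g₁ (by rw [← hc₁, map_zero]))
  refine ⟨c₂ / c₁, sub_eq_zero.mp (hinj _ ?_)⟩
  ext e
  have h1 : g₁ (i e) = c₁ • e := (congrArg (fun f ↦ f e) hc₁).symm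
  have h2 : g₂ (i e) = c₂ • e := (congrArg (fun f ↦ f e) hc₂).symm
  change g₂ (i e) - (c₂ / c₁) • g₁ (i e) = 0
  rw [h1, h2, smul_smul, div_mul_cancel₀ _ hc₁0, sub_self]

end Multiplicity

section Clifford

variable {X H : Type*} [Group X] [Group H]

omit [FiniteDimensional ℂ V] in
theorem nontrivial_coindV [Finite X] [Nontrivial V] (κ : X →* H) (hκ : Function.Injective κ)
    (ρ : Representation ℂ X V) : Nontrivial (coindV κ ρ) := by
  classical
  have := Fintype.ofFinite X
  obtain ⟨v, hv⟩ := exists_ne (0 : V)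
  let f : H → V := fun h ↦ ∑ x : X, if κ x = h then ρ x v else 0
  have hf : f ∈ coindV κ ρ := by
    intro g h
    simp only [f, map_sum]
    refine (Fintype.sum_equiv (Equiv.mulLeft g) _ _ fun x ↦ ?_).symm
    by_cases hx : κ x = h <;> simp [hx]
  refine ⟨⟨f, hf⟩, 0, fun h0 ↦ hv ?_⟩
  have h1 : f 1 = 0 := congrFun (congrArg Subtype.val h0) 1
  have h2 : ∀ x, κ x = 1 ↔ x = 1 := fun x ↦ map_eq_one_iff κ hκ
  simpa [f, h2] using h1

/-- Every representation of `X` admits a nonzero map from the restriction of an irreducible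
representation of `H`. -/
theorem exists_irreducible_intertwiningMap_ne_zero {X : Type*} {H : Type u} {V : Type v} [Group X]
    [Group H] [AddCommGroup V] [Module ℂ V] [FiniteDimensional ℂ V] [Finite X] [Finite H]
    (κ : X →* H) (hκ : Function.Injective κ) (ρ : Representation ℂ X V) [Nontrivial V] :
    ∃ (W : Type (max u v)) (_ : AddCommGroup W) (_ : Module ℂ W) (_ : FiniteDimensional ℂ W)
      (σ : Representation ℂ H W), σ.IsIrreducible ∧
      ∃ π : IntertwiningMap (MonoidHom.comp σ κ) ρ, π ≠ 0 := by
  have := nontrivial_coindV κ hκ ρ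
  obtain ⟨p, hp⟩ := exists_irreducible_subrepresentation (coind κ ρ)
  refine ⟨p.toSubmodule, inferInstance, inferInstance, inferInstance, p.toRepresentation, hp,
    LinearMap.intertwiningMap_of_isIntertwiningMap _ _
    (LinearMap.proj 1 ∘ₗ (coindV κ ρ).subtype ∘ₗ p.toSubmodule.subtype) ?_, ?_⟩
  · intro x f
    have := f.1.2 x 1
    rw [mul_one] at this
    change f.1.1 (1 * κ x) = ρ x (f.1.1 1)
    rw [one_mul, this]
  · intro h0
    refine bot_ne_top (α := Subrepresentation p.toRepresentation) ?_
    apply Subrepresentation.toSubmodule_injective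
    refine ((Submodule.eq_bot_iff _).mpr fun f _ ↦ ?_).symm
    ext h
    have := congrArg (fun g ↦ g (p.toRepresentation h f)) h0
    change f.1.1 (1 * h) = 0 at this
    rwa [one_mul] at this

omit [FiniteDimensional ℂ W] in
/-- An irreducible `σ` lying over an invariant irreducible `ρ` with multiplicity one extends `ρ`. -/
theorem character_comp_eq_of_forall_eq_smul [Finite X] (κ : X →* H) (σ : Representation ℂ H W)
    [IsIrreducible σ] (ρ : Representation ℂ X V) [IsIrreducible ρ]
    (hconj : ∀ h : H, ∃ α : X →* X, (∀ x, κ (α x) = h * κ x * h⁻¹) ∧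
      ∀ x, ρ.character (α x) = ρ.character x)
    (π : IntertwiningMap (MonoidHom.comp σ κ) ρ) (hπ : π ≠ 0)
    (hmul : ∀ g : IntertwiningMap (MonoidHom.comp σ κ) ρ, ∃ c : ℂ, g = c • π) (x : X) :
    σ.character (κ x) = ρ.character x := by
  have hπx (x : X) (w : W) : π (σ (κ x) w) = ρ x (π w) := π.isIntertwining _ _ x w
  let K : Subrepresentation σ := ⟨LinearMap.ker π.toLinearMap, fun h w hw ↦ by
    replace hw : π w = 0 := hw
    change π (σ h w) = 0
    obtain ⟨α, hα, hchar⟩ := hconj h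
    obtain ⟨τ⟩ := nonempty_equiv_of_character_eq ρ (MonoidHom.comp ρ α)
      (funext fun x ↦ (hchar x).symm)
    have hτ (x : X) (v : V) : τ.symm (ρ (α x) v) = ρ x (τ.symm v) :=
      τ.symm.toIntertwiningMap.isIntertwining _ _ x v
    obtain ⟨c, hc⟩ := hmul (LinearMap.intertwiningMap_of_isIntertwiningMap _ _
      (τ.symm.toLinearMap ∘ₗ π.toLinearMap ∘ₗ σ h) (by
        intro x w
        change τ.symm (π (σ h (σ (κ x) w))) = ρ x (τ.symm (π (σ h w)))
        rw [← hτ, ← hπx, hα, ← Module.End.mul_apply, ← Module.End.mul_apply, ← map_mul, ← map_mul,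
          inv_mul_cancel_right]))
    have h1 : τ.symm (π (σ h w)) = c • π w := congrArg (fun g ↦ g w) hc
    rw [hw, smul_zero] at h1
    simpa using h1⟩
  have hK : K = ⊥ := (eq_bot_or_eq_top K).resolve_right fun hK ↦ hπ (by
    ext w
    have : w ∈ K := hK ▸ Submodule.mem_top
    exact this)
  have hinj : Function.Injective π :=
    LinearMap.ker_eq_bot.mp (congrArg Subrepresentation.toSubmodule hK)
  have hsurj := (IsIrreducible.surjective_or_eq_zero π).resolve_right hπ
  exact congrFun (char_iso (π.ofBijective ⟨hinj, hsurj⟩)) x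

end Clifford
end Representation

namespace FDRep

variable {G : Type} [Group G]

theorem isIrreducible_ρ_of_simple (V : FDRep ℂ G) [Simple V] :
    Representation.IsIrreducible (k := ℂ) (V := V) V.ρ := by
  have hnt : Nontrivial V := by
    by_contra h
    rw [not_nontrivial_iff_subsingleton] at h
    apply id_nonzero V
    ext v
    exact Subsingleton.elim _ _
  refine Representation.isIrreducible_of_forall fun p ↦ ?_
  let U : FDRep ℂ G := FDRep.of p.toRepresentation
  let f : U ⟶ V := ⟨FGModuleCat.ofHom p.toSubmodule.subtype, fun g ↦ by
    ext v
    rfl⟩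
  have hf : Function.Injective f := Subtype.val_injective
  have : Mono f := ConcreteCategory.mono_of_injective f hf
  by_cases h0 : f = 0
  · left
    apply Subrepresentation.toSubmodule_injective
    refine (Submodule.eq_bot_iff _).mpr fun v hv ↦ ?_
    exact congrArg (fun f : U ⟶ V ↦ f.hom.hom (⟨v, hv⟩ : p.toSubmodule)) h0
  · right
    apply Subrepresentation.toSubmodule_injective
    have : IsIso f := isIso_of_mono_of_nonzero h0
    refine (Submodule.eq_top_iff'.mpr fun v ↦ ?_)
    obtain ⟨u, hu⟩ := (isoToLinearEquiv (asIso f)).surjective v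
    exact hu ▸ (show p.toSubmodule from u).2

theorem simple_of_isIrreducible [Finite G] {E : Type} [AddCommGroup E] [Module ℂ E]
    [FiniteDimensional ℂ E] (θ : Representation ℂ G E) [θ.IsIrreducible] :
    Simple (FDRep.of θ) := by
  have := Fintype.ofFinite G
  have : Invertible (Nat.card G : ℂ) := invertibleOfNonzero (by simp)
  rw [simple_iff_char_is_norm_one]
  have h := Representation.char_orthonormal θ θ
  rw [if_pos ⟨Representation.Equiv.refl θ⟩, inv_mul_eq_one₀ (by simp)] at h
  exact h.symm

end FDRep

namespace Subgroup

variable {Y : Type*} [Group Y]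

theorem le_inertia_character {V : Type*} [AddCommGroup V] [Module ℂ V] (N : Subgroup Y)
    (hN : N.Normal) (ρ : Representation ℂ N V) : N ≤ inertia N hN ρ.character := by
  intro y hy x hx hx'
  exact ρ.char_conj ⟨x, hx⟩ ⟨y, hy⟩

/-- A nonzero map intertwining `θ` with its conjugate by `y` forces `y` into the inertia group. -/
theorem mem_inertia_of_ne_zero {E : Type*} [AddCommGroup E] [Module ℂ E] [FiniteDimensional ℂ E]
    (N : Subgroup Y) (hN : N.Normal) (θ : Representation ℂ N E) [θ.IsIrreducible] {y : Y}
    {B : E →ₗ[ℂ] E} (hB0 : B ≠ 0)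
    (hB : ∀ a b : N, (b : Y) = y * a * y⁻¹ → B ∘ₗ θ a = θ b ∘ₗ B) :
    y ∈ inertia N hN θ.character := by
  let conj : N →* N := (MulAut.conjNormal y).toMonoidHom
  let f : Representation.IntertwiningMap θ (MonoidHom.comp θ conj) :=
    LinearMap.intertwiningMap_of_isIntertwiningMap _ _ B fun a e ↦
      LinearMap.congr_fun (hB a (conj a) (MulAut.conjNormal_apply y a)) e
  have hf : f ≠ 0 := fun h ↦ hB0 (congrArg Representation.IntertwiningMap.toLinearMap h)
  have hinj := (Representation.IsIrreducible.injective_or_eq_zero f).resolve_right hf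
  have hchar := Representation.char_iso
    (f.ofBijective ⟨hinj, LinearMap.injective_iff_surjective (f := f.toLinearMap).mp hinj⟩)
  intro x hx hx'
  have h1 : (⟨y * x * y⁻¹, hx'⟩ : N) = conj ⟨x, hx⟩ :=
    Subtype.ext (MulAut.conjNormal_apply y (⟨x, hx⟩ : N)).symm
  rw [h1]
  exact (congrFun hchar ⟨x, hx⟩).symm

/-- If `τ` has the same character on `N` as the irreducible representation `θ`, then the action
`θ` of `N` itself extends to `T`. -/
theorem exists_representation_extension [Finite Y] {E F : Type*} [AddCommGroup E] [Module ℂ E]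
    [FiniteDimensional ℂ E] [AddCommGroup F] [Module ℂ F] [FiniteDimensional ℂ F]
    {N T : Subgroup Y} (hNT : N ≤ T) (θ : Representation ℂ N E) [θ.IsIrreducible]
    (τ : Representation ℂ T F) (h : ∀ n : N, τ.character (inclusion hNT n) = θ.character n) :
    ∃ θ' : Representation ℂ T E, ∀ n : N, θ' (inclusion hNT n) = θ n := by
  obtain ⟨e⟩ := Representation.nonempty_equiv_of_character_eq θ
    (MonoidHom.comp τ (inclusion hNT)) (funext fun n ↦ (h n).symm)
  have he (n : N) (v : E) : e (θ n v) = τ (inclusion hNT n) (e v) :=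
    e.toIntertwiningMap.isIntertwining _ _ n v
  refine ⟨MonoidHom.comp (e.toLinearEquiv.symm.conjRingEquiv : Module.End ℂ F →* Module.End ℂ E) τ,
    fun n ↦ ?_⟩
  ext v
  change e.symm (τ (inclusion hNT n) (e v)) = θ n v
  rw [← he]
  simp

end Subgroup

/-- abstract form of Theorem 3.6, second assertion: let `Y` be a finite
group, `N ⊴ Y` with `Y/N` abelian (i.e. all commutators lie in `N`), and suppose every
irreducible complex character of `N` extends to its inertia group.  Then every
intermediate subgroup `N ≤ X ≤ Y` is normal in `Y` and every irreducible complex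
character of `X` extends to its inertia group `Y_χ`. -/
theorem irreducible_character_extends_to_inertia (Y : Type) [Group Y] [Fintype Y]
    (N : Subgroup Y) (hN : N.Normal)
    (hab : ∀ a b : Y, a * b * a⁻¹ * b⁻¹ ∈ N)
    (hext : ∀ V : FDRep ℂ ↥N, Simple V →
      ∃ W : FDRep ℂ ↥(inertia N hN V.character),
        ∀ (n : Y) (hn : n ∈ N) (hn' : n ∈ inertia N hN V.character),
          W.character ⟨n, hn'⟩ = V.character ⟨n, hn⟩) :
    ∀ X : Subgroup Y, N ≤ X →
      ∃ hX : X.Normal,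
        ∀ V : FDRep ℂ ↥X, Simple V →
          ∃ W : FDRep ℂ ↥(inertia X hX V.character),
            ∀ (x : Y) (hx : x ∈ X) (hx' : x ∈ inertia X hX V.character),
              W.character ⟨x, hx'⟩ = V.character ⟨x, hx⟩ := by
  intro X hNX
  have hX : X.Normal := ⟨fun x hx y ↦ by
    simpa using X.mul_mem (hNX (hab y x)) hx⟩
  refine ⟨hX, fun V hV ↦ ?_⟩
  let ρ : Representation ℂ X V := V.ρ
  have hρ : ρ.IsIrreducible := V.isIrreducible_ρ_of_simple
  have hntV : Nontrivial V := by
    by_contra h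
    rw [not_nontrivial_iff_subsingleton] at h
    exact bot_ne_top (Subrepresentation.toSubmodule_injective
      (Subsingleton.elim (⊥ : Subrepresentation ρ).toSubmodule
        (⊤ : Subrepresentation ρ).toSubmodule))
  let Z : Subgroup Y := inertia X hX ρ.character
  have hXZ : X ≤ Z := X.le_inertia_character hX ρ
  have hNZ : N ≤ Z := hNX.trans hXZ
  let κ : X →* Z := Subgroup.inclusion hXZ
  let ι : N →* Z := Subgroup.inclusion hNZ
  obtain ⟨W, _, _, _, σ, hσ, π, hπ⟩ :=
    Representation.exists_irreducible_intertwiningMap_ne_zero κ (Subgroup.inclusion_injective hXZ) ρ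
  obtain ⟨p, hp⟩ := Representation.exists_irreducible_subrepresentation
    (MonoidHom.comp ρ (Subgroup.inclusion hNX))
  let θ := p.toRepresentation
  have hj : ∃ j : Representation.IntertwiningMap θ (MonoidHom.comp ρ (Subgroup.inclusion hNX)),
      j ≠ 0 := by
    refine ⟨LinearMap.intertwiningMap_of_isIntertwiningMap _ _ p.toSubmodule.subtype
      fun _ _ ↦ rfl, fun h0 ↦ ?_⟩
    refine bot_ne_top (α := Subrepresentation θ) ?_
    apply Subrepresentation.toSubmodule_injective
    refine ((Submodule.eq_bot_iff _).mpr fun v _ ↦ ?_).symm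
    exact Subtype.ext (congrArg (fun g ↦ g v) h0)
  obtain ⟨j, hj⟩ := hj
  obtain ⟨q, hq⟩ := Representation.exists_intertwiningMap_ne_zero_symm hj
  have hqρ (n : N) (v : V) : q (ρ (Subgroup.inclusion hNX n) v) = θ n (q v) :=
    q.isIntertwining _ _ n v
  let T₀ : Subgroup Y := inertia N hN θ.character
  have hNT₀ : N ≤ T₀ := N.le_inertia_character hN θ
  obtain ⟨W₀, hW₀⟩ := hext (FDRep.of θ) (FDRep.simple_of_isIrreducible θ)
  obtain ⟨θ₀, hθ₀⟩ := Subgroup.exists_representation_extension hNT₀ θ W₀.ρ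
    fun n ↦ hW₀ n n.2 (hNT₀ n.2)
  let T : Subgroup Z := T₀.subgroupOf Z
  let θ' : Representation ℂ T p.toSubmodule := MonoidHom.comp θ₀ (Z.subtype.subgroupComap T₀)
  let pull (g : Representation.IntertwiningMap (MonoidHom.comp σ κ) ρ) :
      Representation.IntertwiningMap (MonoidHom.comp σ ι) θ :=
    LinearMap.intertwiningMap_of_isIntertwiningMap _ _ (q.toLinearMap ∘ₗ g.toLinearMap) fun n w ↦ by
      have h1 : g (σ (ι n) w) = ρ (Subgroup.inclusion hNX n) (g w) :=
        g.isIntertwining _ _ (Subgroup.inclusion hNX n) w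
      change q (g (σ (ι n) w)) = θ n (q (g w))
      rw [h1, hqρ]
  have hpull (g) (hg : pull g = 0) : g = 0 := by
    refine (Representation.IsIrreducible.surjective_or_eq_zero g).resolve_left fun hsurj ↦ hq ?_
    refine Representation.IntertwiningMap.ext (LinearMap.ext fun v ↦ ?_)
    obtain ⟨w, rfl⟩ := hsurj v
    exact congrArg (fun f ↦ f w) hg
  have hmul (g : Representation.IntertwiningMap (MonoidHom.comp σ κ) ρ) : ∃ c : ℂ, g = c • π := by
    obtain ⟨c, hc⟩ := Representation.intertwiningMap_eq_smul_of_ne_zero ι σ θ T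
      (fun n ↦ hNT₀ n.2) θ' hθ₀
      (fun h n ↦ ⟨⟨h * n * (h : Y)⁻¹, hN.conj_mem _ n.2 h⟩, rfl⟩)
      (fun s t ↦ ⟨⟨_, hab s t⟩, Subtype.ext (by simp [ι, mul_assoc])⟩)
      (fun h hh B hB ↦ by
        by_contra hB0
        exact hh (N.mem_inertia_of_ne_zero hN θ hB0 fun a b hab ↦ hB a b (Subtype.ext hab)))
      (pull π) (pull g) (fun h ↦ hπ (hpull π h))
    refine ⟨c, sub_eq_zero.mp (hpull _ ?_)⟩
    refine Representation.IntertwiningMap.ext (LinearMap.ext fun w ↦ ?_)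
    have h1 : q (g w) = c • q (π w) := congrArg (fun f ↦ f w) hc
    change q (g w - c • π w) = 0
    rw [map_sub, map_smul, h1, sub_self]
  refine ⟨FDRep.of σ, fun x hx hx' ↦ ?_⟩
  refine Representation.character_comp_eq_of_forall_eq_smul κ σ ρ (fun h ↦ ?_) π hπ hmul ⟨x, hx⟩
  refine ⟨(MulAut.conjNormal (h : Y) : MulAut X).toMonoidHom,
    fun y ↦ Subtype.ext (MulAut.conjNormal_apply (h : Y) y), fun y ↦ ?_⟩
  have hy := MulAut.conjNormal_apply (h : Y) y
  have h1 := h.2 y y.2 (hX.conj_mem _ y.2 h)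
  rw [← h1]
  exact congrArg ρ.character (Subtype.ext hy)
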